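/- Invariant Π⁰_{α+1} sets become G_δ in the refined topology: Let x ∈ X, let α ≥ 1 be a countable ordinal, and let A ⊆ B_α(x,∅) be a G-invariant set with A ∈ Π⁰_{α+1}(X). Then A is a G_δ subset of B_α(x,∅) with respect to the topology t^x_α (i.e. a countable intersection of t^x_α-open subsets of B_α(x,∅)). -/

import Mathlib

open Set Pointwise

noncomputable section

/-- `S_∞`, the group of all permutations of `ℕ`. -/
abbrev Sinf : Type := Equiv.Perm ℕ

/-- The topology of pointwise convergence on `S_∞`. -/
instance SinfTopology : TopologicalSpace Sinf :=
  TopologicalSpace.induced (fun g : Sinf => (g : ℕ → ℕ)) Pi.topologicalSpace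

/-- The graph of the restriction of a permutation `g` to a finite set `d`. -/
def restr (g : Sinf) (d : Finset ℕ) : Set (ℕ × ℕ) := {p | p.1 ∈ d ∧ g p.1 = p.2}

/-- The domain of a partial map coded by its graph. -/
def pdom (σ : Set (ℕ × ℕ)) : Set ℕ := Prod.fst '' σ

/-- The range of a partial map coded by its graph. -/
def prng (σ : Set (ℕ × ℕ)) : Set ℕ := Prod.snd '' σ

/-- `S^G_{<∞}`: graphs of restrictions of elements of `G` to finite subsets of `ℕ`. -/
def SGfin (G : Subgroup Sinf) : Set (Set (ℕ × ℕ)) :=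
  {σ | ∃ g ∈ G, ∃ d : Finset ℕ, σ = restr g d}

/-- `V^G_σ`: the elements of `G` extending the partial bijection `σ`. -/
def Vb (G : Subgroup Sinf) (σ : Set (ℕ × ℕ)) : Set G :=
  {g : G | ∀ p ∈ σ, (g : Sinf) p.1 = p.2}

/-- `V^G_c`: the pointwise stabilizer of `c ⊆ ℕ` in `G`. -/
def Vc (G : Subgroup Sinf) (c : Set ℕ) : Set G :=
  {g : G | ∀ k ∈ c, (g : Sinf) k = k}

/-- The identity partial bijection on `c`. -/
def idb (c : Set ℕ) : Set (ℕ × ℕ) := {p | p.1 ∈ c ∧ p.2 = p.1}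

/-- The composition `σ ∘ f`, restricted to `f⁻¹[dom σ]`. -/
def compR (σ : Set (ℕ × ℕ)) (f : Sinf) : Set (ℕ × ℕ) := {p | (f p.1, p.2) ∈ σ}

/-- The composition `f ∘ σ`. -/
def compL (f : Sinf) (σ : Set (ℕ × ℕ)) : Set (ℕ × ℕ) := {p | (p.1, f⁻¹ p.2) ∈ σ}

/-- The Borel classes `Σ⁰_α(X)`: `Σ⁰_1(X)` consists of the open sets, and for `α > 1`,
`Σ⁰_α(X)` consists of countable unions of sets whose complements lie in
`⋃_{1 ≤ β < α} Σ⁰_β(X)` (i.e. of sets from `⋃_{1 ≤ β < α} Π⁰_β(X)`). -/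
def SigmaB (X : Type*) [TopologicalSpace X] (α : Ordinal.{0}) : Set (Set X) :=
  if α ≤ 1 then {s | IsOpen s}
  else {s | ∃ f : ℕ → Set X,
      (∀ n, ∃ β : {γ : Ordinal.{0} // γ < α}, 1 ≤ β.1 ∧ (f n)ᶜ ∈ SigmaB X β.1) ∧
      s = ⋃ n, f n}
termination_by α
decreasing_by exact β.2

/-- The Borel classes `Π⁰_α(X)`: complements of sets in `Σ⁰_α(X)`. -/
def PiB (X : Type*) [TopologicalSpace X] (α : Ordinal.{0}) : Set (Set X) :=
  {s | sᶜ ∈ SigmaB X α}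

section Action

variable (G : Subgroup Sinf) {X : Type*} [TopologicalSpace X] [MulAction G X]

/-- The image `S • x` of a point under a set of group elements. -/
def setOrb (S : Set G) (x : X) : Set X := (fun g : G => g • x) '' S

/-- The image `S • B` of a set under a set of group elements. -/
def setSmul (S : Set G) (B : Set X) : Set X := ⋃ g ∈ S, g • B

/-- The `1`-sets `B₁(x, σ)`. -/
def BsetOne (A : ℕ → Set X) (σ : Set (ℕ × ℕ)) (x : X) : Set X :=
  (⋂ l, ⋂ (_ : (setOrb G (Vb G σ) x ∩ A l).Nonempty), setSmul G (Vc G (prng σ)) (A l)) ∩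
    (⋂ l, ⋂ (_ : setOrb G (Vb G σ) x ∩ A l = ∅), (setSmul G (Vc G (prng σ)) (A l))ᶜ)

/-- The successor step of the recursion defining the `α`-sets. -/
def BsetSucc (prev : Set (ℕ × ℕ) → X → Set X) (σ : Set (ℕ × ℕ)) (x : X) : Set X :=
  (⋂ b : Finset ℕ, ⋂ (_ : pdom σ ⊆ ↑b),
      ⋃ σ' ∈ SGfin G, ⋃ (_ : σ ⊆ σ') (_ : pdom σ' = ↑b), prev σ' x) ∩
    (⋂ a : Finset ℕ, ⋂ (_ : prng σ ⊆ ↑a),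
      ⋃ σ' ∈ SGfin G, ⋃ (_ : σ ⊆ σ') (_ : prng σ' = ↑a), prev σ' x)

/-- The `α`-sets `B_α(x, σ)`, for `α ≥ 1` (the value at `α = 0` is junk). -/
def Bset (A : ℕ → Set X) (α : Ordinal.{0}) : Set (ℕ × ℕ) → X → Set X :=
  @Ordinal.limitRecOn (fun _ => Set (ℕ × ℕ) → X → Set X) α
    (fun _ _ => univ)
    (fun o ih => if o = 0 then BsetOne G A else BsetSucc G ih)
    (fun o _ ih σ x => ⋂ β : Ordinal.{0}, ⋂ (hβ : β < o), ⋂ (_ : 1 ≤ β), ih β hβ σ x)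

/-- The family `𝓑^x_{<α}` consisting of the basic open sets together with all
`β`-sets of `x` for `1 ≤ β < α`. -/
def BltFam (A : ℕ → Set X) (x : X) (α : Ordinal.{0}) : Set (Set X) :=
  {B | (∃ l, B = A l) ∨
    ∃ β : Ordinal.{0}, 1 ≤ β ∧ β < α ∧ ∃ σ ∈ SGfin G, B = Bset G A β σ x}

/-- `γ^G_*(x)`: the least countable ordinal `γ` such that for all `σ, δ ∈ S^G_{<∞}`
with equal ranges, if `B_α(x,σ) ≠ B_α(x,δ)` for some countable ordinal `α ≥ 1`,
then already `B_γ(x,σ) ≠ B_γ(x,δ)`. -/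
def gammaStar (A : ℕ → Set X) (x : X) : Ordinal :=
  sInf {γ : Ordinal.{0} | γ.card ≤ Cardinal.aleph0 ∧
    ∀ σ ∈ SGfin G, ∀ δ ∈ SGfin G, prng σ = prng δ →
      (∃ α : Ordinal.{0}, 1 ≤ α ∧ α.card ≤ Cardinal.aleph0 ∧
        Bset G A α σ x ≠ Bset G A α δ x) →
      Bset G A γ σ x ≠ Bset G A γ δ x}

end Action

/-- The topology on a subset `S ⊆ X` generated by the traces on `S` of the members
of the family `F`. -/
def traceTop {X : Type*} (S : Set X) (F : Set (Set X)) : TopologicalSpace S :=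
  TopologicalSpace.generateFrom {u : Set S | ∃ B ∈ F, u = Subtype.val ⁻¹' B}

/-- The space of closed subsets of `Y`. -/
def EffrosSpace (Y : Type*) [TopologicalSpace Y] := {K : Set Y // IsClosed K}

/-- The Effros Borel structure on the space of closed subsets of `Y`. -/
def effrosSigma (Y : Type*) [TopologicalSpace Y] : MeasurableSpace (EffrosSpace Y) :=
  MeasurableSpace.generateFrom
    {S | ∃ U : Set Y, IsOpen U ∧ S = {K : EffrosSpace Y | (K.1 ∩ U).Nonempty}}

section Helpers

open Topology

/-- Basic open sets of `G` in a convenient parametrization. -/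
def VV (G : Subgroup Sinf) (g : G) (d : Finset ℕ) : Set G :=
  {h : G | ∀ k ∈ d, (h : Sinf) k = (g : Sinf) k}

theorem sinf_continuous_eval (n : ℕ) : Continuous (fun g : Sinf => g n) :=
  (continuous_apply n).comp continuous_induced_dom

theorem sinf_continuous_iff {Y : Type*} [TopologicalSpace Y] (f : Y → Sinf)
    (h : ∀ n, Continuous (fun y => f y n)) : Continuous f :=
  continuous_induced_rng.2 (continuous_pi h)

theorem sinf_continuous_inv_eval (n : ℕ) : Continuous (fun g : Sinf => g⁻¹ n) := by
  rw [continuous_discrete_rng]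
  intro m
  have : (fun g : Sinf => g⁻¹ n) ⁻¹' {m} = (fun g : Sinf => g m) ⁻¹' {n} := by
    ext g
    simp only [mem_preimage, mem_singleton_iff]
    rw [Equiv.Perm.inv_eq_iff_eq]
    exact eq_comm
  rw [this]
  exact (isOpen_discrete _).preimage (sinf_continuous_eval m)

theorem sinf_polish : PolishSpace Sinf := by
  let φ : Sinf → (ℕ → ℕ) × (ℕ → ℕ) := fun g => (fun n => g n, fun n => g⁻¹ n)
  have hc : Continuous φ :=
    (continuous_pi sinf_continuous_eval).prodMk (continuous_pi sinf_continuous_inv_eval)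
  have hemb : IsInducing (fun g : Sinf => (g : ℕ → ℕ)) := ⟨rfl⟩
  have hind : IsInducing φ := by
    have h2 : IsInducing (Prod.fst ∘ φ) := hemb
    exact IsInducing.of_comp hc continuous_fst h2
  have hinj : Function.Injective φ := by
    intro g h hgh
    ext n
    exact congrFun (congrArg Prod.fst hgh) n
  have hrange : range φ = ⋂ n : ℕ, {p : (ℕ → ℕ) × (ℕ → ℕ) | p.1 (p.2 n) = n ∧ p.2 (p.1 n) = n} := by
    ext p
    simp only [mem_range, mem_iInter, mem_setOf_eq]
    constructor
    · rintro ⟨g, rfl⟩ n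
      simp [φ]
    · intro hp
      refine ⟨⟨p.1, p.2, fun n => (hp n).2, fun n => (hp n).1⟩, ?_⟩
      rfl
  have hcl : IsClosed (range φ) := by
    rw [hrange]
    have happ : Continuous (fun q : (ℕ → ℕ) × ℕ => q.1 q.2) := by
      rw [continuous_discrete_rng]
      intro m
      have : (fun q : (ℕ → ℕ) × ℕ => q.1 q.2) ⁻¹' {m} =
          ⋃ k : ℕ, {q : (ℕ → ℕ) × ℕ | q.2 = k} ∩ {q | q.1 k = m} := by
        ext q; simp
      rw [this]
      refine isOpen_iUnion fun k => ?_
      refine IsOpen.inter ((isOpen_discrete {k}).preimage continuous_snd) ?_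
      have hk : Continuous (fun q : (ℕ → ℕ) × ℕ => q.1 k) :=
        (continuous_apply k).comp continuous_fst
      exact (isOpen_discrete {m}).preimage hk
    refine isClosed_iInter fun n => ?_
    refine IsClosed.inter (s₁ := {p : (ℕ → ℕ) × (ℕ → ℕ) | p.1 (p.2 n) = n})
      (s₂ := {p : (ℕ → ℕ) × (ℕ → ℕ) | p.2 (p.1 n) = n}) ?_ ?_
    · exact isClosed_eq (happ.comp
        (continuous_fst.prodMk ((continuous_apply n).comp continuous_snd))) continuous_const
    · exact isClosed_eq (happ.comp
        (continuous_snd.prodMk ((continuous_apply n).comp continuous_fst))) continuous_const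
  exact (IsClosedEmbedding.mk ⟨hind, hinj⟩ hcl).polishSpace

theorem G_baire (G : Subgroup Sinf) (hG : IsClosed (G : Set Sinf)) : BaireSpace G := by
  haveI := sinf_polish
  haveI : PolishSpace (G : Set Sinf) := hG.polishSpace
  exact BaireSpace.of_completelyPseudoMetrizable (X := (G : Set Sinf))

theorem G_mul_left_continuous (G : Subgroup Sinf) (p : G) : Continuous (fun h : G => p * h) := by
  refine Continuous.subtype_mk (f := fun h : G => (p : Sinf) * (h : Sinf)) ?_ _
  refine sinf_continuous_iff _ fun n => ?_
  have : (fun h : G => ((p : Sinf) * (h : Sinf)) n) = (fun k => (p : Sinf) k) ∘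
      (fun h : G => (h : Sinf) n) := rfl
  rw [this]
  exact continuous_of_discreteTopology.comp
    ((sinf_continuous_eval n).comp continuous_subtype_val)

theorem G_meagre_preimage (G : Subgroup Sinf) (p : G) (S : Set G) (hS : IsMeagre S) :
    IsMeagre ((fun h : G => p * h) ⁻¹' S) := by
  refine hS.preimage_of_isOpenMap (G_mul_left_continuous G p) ?_
  intro U hU
  have : (fun h : G => p * h) '' U = (fun h : G => p⁻¹ * h) ⁻¹' U := by
    ext h
    constructor
    · rintro ⟨u, hu, rfl⟩
      simpa using hu
    · intro hh
      exact ⟨p⁻¹ * h, hh, by simp⟩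
  rw [this]
  exact hU.preimage (G_mul_left_continuous G p⁻¹)

theorem G_meagre_preimage_iff (G : Subgroup Sinf) (p : G) (S : Set G) :
    IsMeagre ((fun h : G => p * h) ⁻¹' S) ↔ IsMeagre S := by
  refine ⟨fun h => ?_, G_meagre_preimage G p S⟩
  have := G_meagre_preimage G p⁻¹ _ h
  simpa [preimage_preimage] using this

theorem VV_open (G : Subgroup Sinf) (g : G) (d : Finset ℕ) : IsOpen (VV G g d) := by
  have : VV G g d = ⋂ k ∈ d, {h : G | (h : Sinf) k = (g : Sinf) k} := by
    ext h; simp [VV]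
  rw [this]
  refine isOpen_biInter_finset fun k _ => ?_
  exact (isOpen_discrete {(g : Sinf) k}).preimage
    ((sinf_continuous_eval k).comp continuous_subtype_val)

theorem VV_self (G : Subgroup Sinf) (g : G) (d : Finset ℕ) : g ∈ VV G g d := fun _ _ => rfl

theorem VV_anti (G : Subgroup Sinf) {g g' : G} {d d' : Finset ℕ} (h : g' ∈ VV G g d)
    (hd : d ⊆ d') : VV G g' d' ⊆ VV G g d :=
  fun u hu k hk => (hu k (hd hk)).trans (h k hk)

theorem VV_basis (G : Subgroup Sinf) (U : Set G) (hU : IsOpen U) (g : G) (hg : g ∈ U) :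
    ∃ d : Finset ℕ, VV G g d ⊆ U := by
  have hind : IsInducing (fun g : G => fun n => (g : Sinf) n) := by
    have h1 : IsInducing (fun g : Sinf => (g : ℕ → ℕ)) := ⟨rfl⟩
    exact h1.comp IsInducing.subtypeVal
  obtain ⟨W, hW, rfl⟩ := hind.isOpen_iff.1 hU
  obtain ⟨I, u, hu, hsub⟩ := isOpen_pi_iff.1 hW _ hg
  refine ⟨I, fun h hh => hsub ?_⟩
  intro k hk
  have := hh k hk
  simp only [this]
  exact (hu k hk).2

section Act

variable {G : Subgroup Sinf} {X : Type*} [TopologicalSpace X] [MulAction G X]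

/-- The forcing relation: for comeagrely many `h ∈ V`, `h • y ∈ E`. -/
def Ms (y : X) (V : Set G) (E : Set X) : Prop := IsMeagre {h : G | h ∈ V ∧ h • y ∉ E}

theorem Ms_mono {y : X} {V W : Set G} (E : Set X) (h : V ⊆ W) (hW : Ms y W E) : Ms y V E :=
  by
  unfold Ms at hW ⊢
  refine hW.mono ?_
  rintro u ⟨h1, h2⟩
  exact ⟨h h1, h2⟩

theorem Ms_translate (y : X) (p q : G) (a : Finset ℕ) (E : Set X) :
    Ms y (VV G (p * q) a) E ↔ Ms y (VV G q a) ((fun z : X => p • z) ⁻¹' E) := by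
  unfold Ms
  rw [← G_meagre_preimage_iff G p]
  have : (fun h : G => p * h) ⁻¹' {h : G | h ∈ VV G (p * q) a ∧ h • y ∉ E} =
      {h : G | h ∈ VV G q a ∧ h • y ∉ (fun z : X => p • z) ⁻¹' E} := by
    ext h
    simp [VV, mul_smul]
  rw [this]

theorem SigmaB_one {X : Type*} [TopologicalSpace X] {α : Ordinal.{0}} (h : α ≤ 1) :
    SigmaB X α = {s | IsOpen s} := by
  rw [SigmaB, if_pos h]

theorem SigmaB_gt {X : Type*} [TopologicalSpace X] {α : Ordinal.{0}} (h : ¬ α ≤ 1) (s : Set X) :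
    s ∈ SigmaB X α ↔ ∃ f : ℕ → Set X,
      (∀ n, ∃ β : Ordinal.{0}, β < α ∧ 1 ≤ β ∧ f n ∈ PiB X β) ∧ s = ⋃ n, f n := by
  rw [SigmaB, if_neg h]
  constructor
  · rintro ⟨f, hf, rfl⟩
    refine ⟨f, fun n => ?_, rfl⟩
    obtain ⟨β, h1, h2⟩ := hf n
    exact ⟨β.1, β.2, h1, h2⟩
  · rintro ⟨f, hf, rfl⟩
    refine ⟨f, fun n => ?_, rfl⟩
    obtain ⟨β, h0, h1, h2⟩ := hf n
    exact ⟨⟨β, h0⟩, h1, h2⟩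

theorem SigmaB_preimage {X Y : Type*} [TopologicalSpace X] [TopologicalSpace Y] (φ : Y → X)
    (hφ : Continuous φ) (α : Ordinal.{0}) :
    ∀ s ∈ SigmaB X α, φ ⁻¹' s ∈ SigmaB Y α := by
  induction α using WellFoundedLT.induction with
  | ind α ih =>
    intro s hs
    by_cases h : α ≤ 1
    · rw [SigmaB_one h] at hs ⊢
      exact IsOpen.preimage hφ hs
    · rw [SigmaB_gt h] at hs ⊢
      obtain ⟨f, hf, rfl⟩ := hs
      refine ⟨fun n => φ ⁻¹' f n, fun n => ?_, by simp⟩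
      obtain ⟨β, h0, h1, h2⟩ := hf n
      exact ⟨β, h0, h1, ih β h0 _ h2⟩

theorem PiB_preimage {X Y : Type*} [TopologicalSpace X] [TopologicalSpace Y] (φ : Y → X)
    (hφ : Continuous φ) (α : Ordinal.{0}) (s : Set X) (hs : s ∈ PiB X α) :
    φ ⁻¹' s ∈ PiB Y α :=
  SigmaB_preimage φ hφ α _ hs

theorem SigmaB_baire {Y : Type*} [TopologicalSpace Y] (α : Ordinal.{0}) :
    ∀ s ∈ SigmaB Y α, BaireMeasurableSet s := by
  induction α using WellFoundedLT.induction with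
  | ind α ih =>
    intro s hs
    by_cases h : α ≤ 1
    · rw [SigmaB_one h] at hs
      exact IsOpen.baireMeasurableSet hs
    · rw [SigmaB_gt h] at hs
      obtain ⟨f, hf, rfl⟩ := hs
      refine BaireMeasurableSet.iUnion fun n => ?_
      obtain ⟨β, h0, h1, h2⟩ := hf n
      exact BaireMeasurableSet.of_compl (ih β h0 _ h2)

theorem localize (y : X) (E : Set X) (hE : BaireMeasurableSet {h : G | h • y ∈ E})
    (g : G) (d : Finset ℕ) (hn : ¬ IsMeagre {h : G | h ∈ VV G g d ∧ h • y ∈ E}) :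
    ∃ g' ∈ VV G g d, ∃ d' : Finset ℕ, d ⊆ d' ∧ Ms y (VV G g' d') E := by
  obtain ⟨u, hu, heq⟩ := hE.residualEq_isOpen
  have hres : {h : G | h • y ∈ E ↔ h ∈ u} ∈ residual G := by
    have := Filter.eventuallyEq_set.1 heq
    exact this
  have hm : IsMeagre {h : G | h • y ∈ E ↔ h ∈ u}ᶜ := by
    unfold IsMeagre; rwa [compl_compl]
  have hne : (VV G g d ∩ u).Nonempty := by
    by_contra hemp
    rw [not_nonempty_iff_eq_empty] at hemp
    refine hn (hm.mono ?_)
    rintro h ⟨h1, h2⟩ h3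
    have : h ∈ VV G g d ∩ u := ⟨h1, h3.1 h2⟩
    rw [hemp] at this
    exact this
  obtain ⟨g', hg1, hg2⟩ := hne
  obtain ⟨d0, hd0⟩ := VV_basis G u hu g' hg2
  refine ⟨g', hg1, d ∪ d0, Finset.subset_union_left, hm.mono ?_⟩
  rintro h ⟨h1, h2⟩ h3
  exact h2 (h3.2 (hd0 fun k hk => h1 k (Finset.mem_union_right _ hk)))

theorem not_meagre_of_Ms [BaireSpace G] (y : X) (E : Set X) (g g' : G) (d d' : Finset ℕ)
    (hg : g' ∈ VV G g d) (hd : d ⊆ d') (h : Ms y (VV G g' d') E) :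
    ¬ IsMeagre {h : G | h ∈ VV G g d ∧ h • y ∈ E} := by
  intro hm
  refine not_isMeagre_of_isOpen (VV_open G g' d') ⟨g', VV_self G g' d'⟩ ((hm.union h).mono ?_)
  intro u hu
  by_cases hE : u • y ∈ E
  · exact Or.inl ⟨VV_anti G hg hd hu, hE⟩
  · exact Or.inr ⟨hu, hE⟩

theorem localize_iff [BaireSpace G] (y : X) (E : Set X)
    (hE : BaireMeasurableSet {h : G | h • y ∈ E}) (g : G) (d : Finset ℕ) :
    (¬ IsMeagre {h : G | h ∈ VV G g d ∧ h • y ∈ E}) ↔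
    ∃ g' ∈ VV G g d, ∃ d' : Finset ℕ, d ⊆ d' ∧ Ms y (VV G g' d') E :=
  ⟨localize y E hE g d, fun ⟨g', h1, d', h2, h3⟩ => not_meagre_of_Ms y E g g' d d' h1 h2 h3⟩

/-! ### The `α`-sets -/

theorem Bset_one' (A : ℕ → Set X) : Bset G A 1 = BsetOne G A := by
  have : (1 : Ordinal.{0}) = 0 + 1 := by simp
  rw [this, Bset, Ordinal.limitRecOn_add_one, if_pos rfl]

theorem Bset_succ' (A : ℕ → Set X) (β : Ordinal.{0}) (h : 1 ≤ β) :
    Bset G A (β + 1) = BsetSucc G (Bset G A β) := by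
  have h0 : β ≠ 0 := by
    rintro rfl
    simp at h
  rw [Bset, Ordinal.limitRecOn_add_one, if_neg h0]
  rfl

theorem Bset_limit' (A : ℕ → Set X) (o : Ordinal.{0}) (h : Order.IsSuccLimit o)
    (σ : Set (ℕ × ℕ)) (x : X) :
    Bset G A o σ x = ⋂ β : Ordinal.{0}, ⋂ (_ : β < o), ⋂ (_ : 1 ≤ β), Bset G A β σ x := by
  rw [Bset, Ordinal.limitRecOn_limit (h := h)]
  rfl

theorem pdom_restr (g : Sinf) (d : Finset ℕ) : pdom (restr g d) = ↑d := by
  ext k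
  simp [pdom, restr]

theorem prng_restr (g : Sinf) (d : Finset ℕ) : prng (restr g d) = ↑(d.image g) := by
  ext k
  constructor
  · rintro ⟨⟨a, b⟩, ⟨h1, h2⟩, rfl⟩
    exact Finset.mem_coe.2 (Finset.mem_image.2 ⟨a, h1, h2⟩)
  · intro hk
    obtain ⟨a, h1, h2⟩ := Finset.mem_image.1 (Finset.mem_coe.1 hk)
    exact ⟨(a, k), ⟨h1, h2⟩, rfl⟩

theorem restr_subset {g g' : Sinf} {d d' : Finset ℕ} (h : restr g d ⊆ restr g' d') :
    d ⊆ d' ∧ ∀ k ∈ d, g' k = g k := by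
  constructor
  · intro k hk
    exact (h (show (k, g k) ∈ restr g d from ⟨hk, rfl⟩)).1
  · intro k hk
    exact (h (show (k, g k) ∈ restr g d from ⟨hk, rfl⟩)).2

theorem restr_congr {g g' : Sinf} {d : Finset ℕ} (h : ∀ k ∈ d, g' k = g k) :
    restr g' d = restr g d := by
  ext ⟨a, b⟩
  simp only [restr, mem_setOf_eq]
  constructor
  · rintro ⟨h1, h2⟩; exact ⟨h1, by rw [← h a h1]; exact h2⟩
  · rintro ⟨h1, h2⟩; exact ⟨h1, by rw [h a h1]; exact h2⟩

theorem Bset_succ_dom (A : ℕ → Set X) (x y : X) (β : Ordinal.{0}) (hβ : 1 ≤ β) (g : G)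
    (d : Finset ℕ) (hy : y ∈ Bset G A (β + 1) (restr g d) x) (b : Finset ℕ) (hb : d ⊆ b) :
    ∃ g' ∈ VV G g d, y ∈ Bset G A β (restr g' b) x := by
  rw [Bset_succ' A β hβ] at hy
  have := hy.1
  simp only [mem_iInter, mem_iUnion] at this
  obtain ⟨σ', ⟨g', hg', d', rfl⟩, h1, h2, h3⟩ := this b (by rw [pdom_restr]; exact_mod_cast hb)
  rw [pdom_restr] at h2
  have h2 : d' = b := by exact_mod_cast h2
  subst h2
  exact ⟨⟨g', hg'⟩, (restr_subset h1).2, h3⟩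

theorem Bset_succ_rng (A : ℕ → Set X) (x y : X) (β : Ordinal.{0}) (hβ : 1 ≤ β) (g : G)
    (d : Finset ℕ) (hy : y ∈ Bset G A (β + 1) (restr g d) x) (a : Finset ℕ)
    (ha : d.image (g : Sinf) ⊆ a) :
    ∃ g' ∈ VV G g d, ∃ d' : Finset ℕ, d ⊆ d' ∧ d'.image (g' : Sinf) = a ∧
      y ∈ Bset G A β (restr g' d') x := by
  rw [Bset_succ' A β hβ] at hy
  have := hy.2
  simp only [mem_iInter, mem_iUnion] at this
  obtain ⟨σ', ⟨g', hg', d', rfl⟩, h1, h2, h3⟩ := this a (by rw [prng_restr]; exact_mod_cast ha)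
  rw [prng_restr] at h2
  have h2 : d'.image g' = a := by exact_mod_cast h2
  exact ⟨⟨g', hg'⟩, (restr_subset h1).2, d', (restr_subset h1).1, h2, h3⟩

theorem Bset_mono (A : ℕ → Set X) (x : X) (γ β : Ordinal.{0}) (hγ : 1 ≤ γ) (h : γ ≤ β) (g : G)
    (d : Finset ℕ) : Bset G A β (restr g d) x ⊆ Bset G A γ (restr g d) x := by
  induction β using Ordinal.limitRecOn with
  | zero =>
    have := hγ.trans h
    simp at this
  | add_one β ih =>
    rcases h.eq_or_lt with h | h
    · rw [h]
    · have h' : γ ≤ β := Order.lt_add_one_iff.1 h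
      intro y hy
      obtain ⟨g', h1, h2⟩ := Bset_succ_dom A x y β (hγ.trans h') g d hy d subset_rfl
      rw [restr_congr h1] at h2
      exact ih h' h2
  | limit β hl ih =>
    rcases h.eq_or_lt with h | h
    · rw [h]
    · rw [Bset_limit' A β hl]
      intro y hy
      simp only [mem_iInter] at hy
      exact hy γ h hγ

theorem Bset_lt_succ (A : ℕ → Set X) (x : X) (γ β : Ordinal.{0}) (hγ : 1 ≤ γ) (h : γ < β) (g : G)
    (d : Finset ℕ) : Bset G A β (restr g d) x ⊆ Bset G A (γ + 1) (restr g d) x :=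
  Bset_mono A x (γ + 1) β (hγ.trans (le_self_add)) (Order.add_one_le_of_lt h) g d

theorem Bset_dom (A : ℕ → Set X) (x y : X) (γ β : Ordinal.{0}) (hγ : 1 ≤ γ) (h : γ < β) (g : G)
    (d : Finset ℕ) (hy : y ∈ Bset G A β (restr g d) x) (b : Finset ℕ) (hb : d ⊆ b) :
    ∃ g' ∈ VV G g d, y ∈ Bset G A γ (restr g' b) x :=
  Bset_succ_dom A x y γ hγ g d (Bset_lt_succ A x γ β hγ h g d hy) b hb

theorem Bset_rng (A : ℕ → Set X) (x y : X) (γ β : Ordinal.{0}) (hγ : 1 ≤ γ) (h : γ < β) (g : G)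
    (d : Finset ℕ) (hy : y ∈ Bset G A β (restr g d) x) (a : Finset ℕ)
    (ha : d.image (g : Sinf) ⊆ a) :
    ∃ g' ∈ VV G g d, ∃ d' : Finset ℕ, d ⊆ d' ∧ d'.image (g' : Sinf) = a ∧
      y ∈ Bset G A γ (restr g' d') x :=
  Bset_succ_rng A x y γ hγ g d (Bset_lt_succ A x γ β hγ h g d hy) a ha

theorem Bset_one_iff (A : ℕ → Set X) (x y : X) (g : G) (d : Finset ℕ)
    (hy : y ∈ Bset G A 1 (restr g d) x) (l : ℕ) :
    (∃ h ∈ VV G 1 (d.image (g : Sinf)), h • y ∈ A l) ↔ (∃ h ∈ VV G g d, h • x ∈ A l) := by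
  rw [Bset_one'] at hy
  have h1 : (setOrb G (Vb G (restr g d)) x ∩ A l).Nonempty ↔ ∃ h ∈ VV G g d, h • x ∈ A l := by
    constructor
    · rintro ⟨_, ⟨h, hh, rfl⟩, hA⟩
      exact ⟨h, fun k hk => hh (k, (g : Sinf) k) ⟨hk, rfl⟩, hA⟩
    · rintro ⟨h, hh, hA⟩
      refine ⟨h • x, ⟨h, ?_, rfl⟩, hA⟩
      rintro ⟨a, b⟩ ⟨hp1, hp2⟩
      exact (hh a hp1).trans hp2
  have h2 : y ∈ setSmul G (Vc G (prng (restr g d))) (A l) ↔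
      ∃ h ∈ VV G 1 (d.image (g : Sinf)), h • y ∈ A l := by
    rw [prng_restr]
    simp only [setSmul, mem_iUnion]
    constructor
    · rintro ⟨h, hh, hA⟩
      rw [mem_smul_set_iff_inv_smul_mem] at hA
      refine ⟨h⁻¹, fun k hk => ?_, hA⟩
      have := hh k (by exact_mod_cast hk)
      simp only [Subgroup.coe_inv, Subgroup.coe_one, Equiv.Perm.one_apply]
      rw [Equiv.Perm.inv_eq_iff_eq]
      exact this.symm
    · rintro ⟨h, hh, hA⟩
      refine ⟨h⁻¹, fun k hk => ?_, ?_⟩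
      · have := hh k (by exact_mod_cast hk)
        simp only [Subgroup.coe_inv]
        rw [Equiv.Perm.inv_eq_iff_eq]
        exact this.symm
      · rw [mem_smul_set_iff_inv_smul_mem, inv_inv]
        exact hA
  obtain ⟨ha, hb⟩ := hy
  simp only [mem_iInter] at ha hb
  rw [← h1, ← h2]
  constructor
  · intro h
    by_contra hc
    exact hb l (not_nonempty_iff_eq_empty.1 hc) h
  · exact ha l

theorem Ms_closed [BaireSpace G] [ContinuousSMul G X] (y : X) (g : G) (d : Finset ℕ) (E : Set X)
    (hE : IsOpen Eᶜ) : Ms y (VV G g d) E ↔ ∀ h ∈ VV G g d, h • y ∈ E := by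
  constructor
  · intro hm h hh
    by_contra hc
    have hopen : IsOpen {h : G | h ∈ VV G g d ∧ h • y ∉ E} := by
      refine IsOpen.inter (VV_open G g d) ?_
      exact hE.preimage (continuous_id.smul continuous_const)
    exact not_isMeagre_of_isOpen hopen ⟨h, hh, hc⟩ hm
  · intro h
    have : {h : G | h ∈ VV G g d ∧ h • y ∉ E} = ∅ := by
      ext u
      simp only [mem_setOf_eq, mem_empty_iff_false, iff_false, not_and, not_not]
      exact h u
    unfold Ms
    rw [this]
    exact IsMeagre.empty

theorem baire_pre [ContinuousSMul G X] (y : X) (α : Ordinal.{0}) (E : Set X)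
    (hE : E ∈ PiB X α) : BaireMeasurableSet {h : G | h • y ∈ E} := by
  refine BaireMeasurableSet.of_compl ?_
  exact SigmaB_baire α _ (SigmaB_preimage (fun h : G => h • y)
    (continuous_id.smul continuous_const) α _ hE)

theorem Ms_iff_forall [BaireSpace G] (y : X) (V : Set G) (E : Set X) (f : ℕ → Set X)
    (hf : Eᶜ = ⋃ n, f n) : Ms y V E ↔ ∀ n, IsMeagre {h : G | h ∈ V ∧ h • y ∈ f n} := by
  have hs : {h : G | h ∈ V ∧ h • y ∉ E} = ⋃ n, {h : G | h ∈ V ∧ h • y ∈ f n} := by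
    ext h
    have : h • y ∉ E ↔ h • y ∈ ⋃ n, f n := by rw [← hf]; rfl
    simp only [mem_setOf_eq, this, mem_iUnion]
    constructor
    · rintro ⟨a, n, b⟩; exact ⟨n, a, b⟩
    · rintro ⟨n, a, b⟩; exact ⟨a, n, b⟩
  unfold Ms
  rw [hs]
  exact ⟨fun h n => h.mono (subset_iUnion (fun n => {h : G | h ∈ V ∧ h • y ∈ f n}) n),
    fun h => isMeagre_iUnion h⟩

theorem main_lemma [BaireSpace G] [ContinuousSMul G X] (A : ℕ → Set X)
    (hbasis : TopologicalSpace.IsTopologicalBasis (Set.range A)) (x : X) (γ : Ordinal.{0}) :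
    1 ≤ γ → ∀ E ∈ PiB X γ, ∀ (g : G) (d : Finset ℕ) (y : X), y ∈ Bset G A γ (restr g d) x →
      (Ms y (VV G 1 (d.image (g : Sinf))) E ↔ Ms x (VV G g d) E) := by
  induction γ using WellFoundedLT.induction with
  | ind γ ih =>
    intro hγ E hE g d y hy
    by_cases h1 : γ ≤ 1
    · have hγ1 : γ = 1 := le_antisymm h1 hγ
      subst hγ1
      have hopen : IsOpen Eᶜ := by
        have : Eᶜ ∈ SigmaB X 1 := hE
        rw [SigmaB_one le_rfl] at this
        exact this
      rw [Ms_closed _ _ _ _ hopen, Ms_closed _ _ _ _ hopen]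
      have key : ∀ (z : X) (V : Set G), (∀ h ∈ V, h • z ∈ E) ↔
          ∀ l, A l ⊆ Eᶜ → ¬ ∃ h ∈ V, h • z ∈ A l := by
        intro z V
        constructor
        · rintro hall l hl ⟨h, hh, hA⟩
          exact hl hA (hall h hh)
        · intro hall h hh
          by_contra hc
          obtain ⟨_, ⟨l, rfl⟩, hm, hs⟩ := hbasis.exists_subset_of_mem_open
            (show h • z ∈ Eᶜ from hc) hopen
          exact hall l hs ⟨h, hh, hm⟩
      rw [key, key]
      simp only [Bset_one_iff A x y g d hy]
    · have hE' : Eᶜ ∈ SigmaB X γ := hE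
      rw [SigmaB_gt h1] at hE'
      obtain ⟨f, hf, hEf⟩ := hE'
      rw [Ms_iff_forall y _ E f hEf, Ms_iff_forall x _ E f hEf]
      refine forall_congr' fun n => ?_
      obtain ⟨β, hβγ, hβ, hfn⟩ := hf n
      rw [← not_iff_not, localize_iff y _ (baire_pre y β _ hfn),
        localize_iff x _ (baire_pre x β _ hfn)]
      constructor
      · rintro ⟨p, hp, a, hda, hM⟩
        obtain ⟨g', hg', d', hdd', rfl, hyB⟩ := Bset_rng A x y β γ hβ hβγ g d hy a hda
        refine ⟨p * g', ?_, d', hdd', ?_⟩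
        · intro k hk
          have e1 : (g' : Sinf) k = (g : Sinf) k := hg' k hk
          have e2 := hp ((g : Sinf) k) (Finset.mem_image_of_mem _ hk)
          simp only [Subgroup.coe_mul, Equiv.Perm.mul_apply, e1]
          simpa using e2
        · rw [Ms_translate]
          rw [← ih β hβγ hβ _ (PiB_preimage _ (continuous_const_smul p) β _ hfn) g' d' y hyB]
          rw [← Ms_translate, mul_one]
          exact hM
      · rintro ⟨g₁, hg₁, b, hdb, hM⟩
        obtain ⟨g', hg', hyB⟩ := Bset_dom A x y β γ hβ hβγ g d hy b hdb
        refine ⟨g₁ * g'⁻¹, ?_, b.image (g' : Sinf), ?_, ?_⟩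
        · intro k hk
          obtain ⟨j, hj, rfl⟩ := Finset.mem_image.1 hk
          have e1 : (g' : Sinf) j = (g : Sinf) j := hg' j hj
          have e2 : (g₁ : Sinf) j = (g : Sinf) j := hg₁ j hj
          have e3 : (g' : Sinf)⁻¹ ((g : Sinf) j) = j := by
            rw [Equiv.Perm.inv_eq_iff_eq]
            exact e1.symm
          simp only [Subgroup.coe_mul, Subgroup.coe_inv, Equiv.Perm.mul_apply, e3, e2,
            Subgroup.coe_one, Equiv.Perm.one_apply]
        · intro k hk
          obtain ⟨j, hj, rfl⟩ := Finset.mem_image.1 hk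
          rw [← hg' j hj]
          exact Finset.mem_image_of_mem _ (hdb hj)
        · have := (Ms_translate x (g₁ * g'⁻¹) g' b (f n)).1 (by simpa using hM)
          rw [← ih β hβγ hβ _ (PiB_preimage _ (continuous_const_smul _) β _ hfn) g' b y hyB,
            ← Ms_translate, mul_one] at this
          exact this

theorem trace_open_of_open (A : ℕ → Set X)
    (hbasis : TopologicalSpace.IsTopologicalBasis (Set.range A)) (S : Set X) (F : Set (Set X))
    (hF : ∀ l, A l ∈ F) (W : Set X) (hW : IsOpen W) :
    @IsOpen _ (traceTop S F) (Subtype.val ⁻¹' W : Set S) := by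
  letI := traceTop S F
  rw [isOpen_iff_forall_mem_open]
  intro y hy
  obtain ⟨_, ⟨l, rfl⟩, hm, hs⟩ := hbasis.exists_subset_of_mem_open hy hW
  exact ⟨Subtype.val ⁻¹' A l, preimage_mono hs,
    TopologicalSpace.isOpen_generateFrom_of_mem ⟨A l, hF l, rfl⟩, hm⟩

theorem restr_one_empty : restr ((1 : G) : Sinf) ∅ = ∅ := by
  ext p
  simp [restr]

theorem W_open [BaireSpace G] [ContinuousSMul G X] (A : ℕ → Set X)
    (hbasis : TopologicalSpace.IsTopologicalBasis (Set.range A)) (x : X) (α β : Ordinal.{0})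
    (hβα : β ≤ α) (F : Set X) (hF : F ∈ SigmaB X β) (g : G) (d : Finset ℕ) :
    @IsOpen _ (traceTop (Bset G A α (∅ : Set (ℕ × ℕ)) x) (BltFam G A x α))
      {y | ¬ IsMeagre {h : G | h ∈ VV G g d ∧ h • (y : X) ∈ F}} := by
  by_cases h1 : β ≤ 1
  · have hFo : IsOpen F := by
      rw [SigmaB_one h1] at hF
      exact hF
    have heq : {y : Bset G A α (∅ : Set (ℕ × ℕ)) x |
        ¬ IsMeagre {h : G | h ∈ VV G g d ∧ h • (y : X) ∈ F}} =
        Subtype.val ⁻¹' (⋃ h ∈ VV G g d, (fun z : X => h • z) ⁻¹' F) := by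
      ext y
      simp only [mem_setOf_eq, mem_preimage, mem_iUnion]
      have := Ms_closed (y : X) g d Fᶜ (by rwa [compl_compl])
      unfold Ms at this
      simp only [mem_compl_iff, not_not] at this
      rw [this]
      push Not
      simp
    rw [heq]
    refine trace_open_of_open A hbasis _ _ (fun l => Or.inl ⟨l, rfl⟩) _ ?_
    exact isOpen_biUnion fun h _ => hFo.preimage (continuous_const_smul h)
  · rw [SigmaB_gt h1] at hF
    obtain ⟨f, hf, rfl⟩ := hF
    letI := traceTop (Bset G A α (∅ : Set (ℕ × ℕ)) x) (BltFam G A x α)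
    rw [isOpen_iff_forall_mem_open]
    intro y hy
    have hex : ∃ n, ¬ IsMeagre {h : G | h ∈ VV G g d ∧ h • (y : X) ∈ f n} := by
      by_contra hc
      push Not at hc
      refine hy ((isMeagre_iUnion hc).mono ?_)
      rintro h ⟨h1, h2⟩
      obtain ⟨n, hn⟩ := mem_iUnion.1 h2
      exact mem_iUnion.2 ⟨n, h1, hn⟩
    obtain ⟨n, hn⟩ := hex
    obtain ⟨γ, hγβ, hγ, hfn⟩ := hf n
    obtain ⟨p, hp, a, hda, hM⟩ := localize (y : X) (f n) (baire_pre _ γ _ hfn) g d hn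
    have hyB : (y : X) ∈ Bset G A α (restr ((1 : G) : Sinf) ∅) x := by
      rw [restr_one_empty]; exact y.2
    obtain ⟨g', -, d', -, rfl, hyB'⟩ := Bset_rng A x y γ α hγ (hγβ.trans_le hβα) 1 ∅ hyB a (by simp)
    have hpre := PiB_preimage _ (continuous_const_smul p) γ _ hfn
    refine ⟨Subtype.val ⁻¹' Bset G A γ (restr g' d') x, ?_,
      TopologicalSpace.isOpen_generateFrom_of_mem ⟨_, Or.inr ⟨γ, hγ, hγβ.trans_le hβα, _,
        ⟨g', g'.2, d', rfl⟩, rfl⟩, rfl⟩, hyB'⟩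
    intro z hz
    rw [← mul_one p, Ms_translate, main_lemma A hbasis x γ hγ _ hpre g' d' y hyB',
      ← main_lemma A hbasis x γ hγ _ hpre g' d' z hz, ← Ms_translate, mul_one] at hM
    have := not_meagre_of_Ms (z : X) (f n) g p d _ hp hda hM
    intro hm
    refine this (hm.mono ?_)
    rintro h ⟨h1, h2⟩
    exact ⟨h1, mem_iUnion.2 ⟨n, h2⟩⟩

theorem SGfin_countable (G : Subgroup Sinf) : (SGfin G).Countable := by
  refine Set.Countable.mono ?_ (Set.Countable.setOf_finite (α := ℕ × ℕ))
  rintro σ ⟨g, -, d, rfl⟩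
  refine Set.Finite.subset ((d.finite_toSet).image fun k => (k, g k)) ?_
  rintro ⟨a, b⟩ ⟨h1, h2⟩
  exact ⟨a, h1, by simpa using h2⟩

end Act

end Helpers

/-- Invariant Π⁰_{α+1} sets become G_δ in the refined topology. -/
theorem invariant_pi_set_Gdelta_in_refined_topology
    (G : Subgroup Sinf) (hGclosed : IsClosed (G : Set Sinf))
    {X : Type*} [TopologicalSpace X] [PolishSpace X] [MulAction G X] [ContinuousSMul G X]
    (A : ℕ → Set X) (hbasis : TopologicalSpace.IsTopologicalBasis (Set.range A))
    (hbasisInv : ∀ l, ∃ c : Finset ℕ, ∀ g ∈ Vc G (↑c : Set ℕ), g • A l = A l)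
    (x : X) (α : Ordinal.{0}) (hα : 1 ≤ α) (hαc : α.card ≤ Cardinal.aleph0)
    (B : Set X) (hsub : B ⊆ Bset G A α (∅ : Set (ℕ × ℕ)) x)
    (hGinv : ∀ g : G, g • B = B) (hpi : B ∈ PiB X (α + 1)) :
    ∃ U : ℕ → Set ↥(Bset G A α (∅ : Set (ℕ × ℕ)) x),
      (∀ n, @IsOpen _ (traceTop (Bset G A α (∅ : Set (ℕ × ℕ)) x) (BltFam G A x α)) (U n)) ∧
      Subtype.val ⁻¹' B = ⋂ n, U n := by
  haveI : BaireSpace G := G_baire G hGclosed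
  have hc1 : ¬ α + 1 ≤ 1 := by
    intro h
    exact absurd (Order.add_one_le_iff.1 h) (not_lt.2 hα)
  have hpi' : Bᶜ ∈ SigmaB X (α + 1) := hpi
  rw [SigmaB_gt hc1] at hpi'
  obtain ⟨f, hf, hBf⟩ := hpi'
  choose β hβα hβ hfβ using hf
  let S := Bset G A α (∅ : Set (ℕ × ℕ)) x
  have hcount : Countable (SGfin G) := (SGfin_countable G).to_subtype
  have hVV : ∀ (g : G) (d : Finset ℕ), Vb G (restr g d) = VV G g d := by
    intro g d
    ext h
    constructor
    · intro hh k hk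
      exact hh (k, (g : Sinf) k) ⟨hk, rfl⟩
    · rintro hh ⟨a, b⟩ ⟨hp1, hp2⟩
      exact (hh a hp1).trans hp2
  letI := traceTop S (BltFam G A x α)
  have hG : IsGδ (Subtype.val ⁻¹' B : Set S) := by
    have heq : (Subtype.val ⁻¹' B : Set S) = ⋂ i : ℕ × SGfin G,
        {y : S | ¬ IsMeagre {h : G | h ∈ Vb G i.2.1 ∧ h • (y : X) ∈ (f i.1)ᶜ}} := by
      ext y
      simp only [mem_preimage, mem_iInter, mem_setOf_eq, Prod.forall, Subtype.forall]
      constructor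
      · rintro hy n σ ⟨g, hg, d, rfl⟩ hm
        have hVg := hVV ⟨g, hg⟩ d
        simp only at hVg
        rw [hVg] at hm
        refine not_isMeagre_of_isOpen (VV_open G ⟨g, hg⟩ d) ⟨_, VV_self G _ d⟩ (hm.mono ?_)
        intro h hh
        refine ⟨hh, fun hfn => ?_⟩
        have h1 : h • (y : X) ∈ Bᶜ := by rw [hBf]; exact mem_iUnion.2 ⟨n, hfn⟩
        apply h1
        rw [← hGinv h]
        exact smul_mem_smul_set hy
      · intro hall
        have hm : Ms (y : X) (VV G 1 ∅) B := by
          rw [Ms_iff_forall _ _ B f hBf]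
          intro n
          by_contra hn
          obtain ⟨g', -, d', -, hM⟩ := localize (y : X) (f n) (baire_pre _ _ _ (hfβ n)) 1 ∅ hn
          refine hall n (restr g' d') ⟨g', g'.2, d', rfl⟩ ?_
          rw [hVV]
          exact hM
        by_contra hy
        refine not_isMeagre_of_isOpen (VV_open G 1 ∅) ⟨_, VV_self G _ _⟩ (hm.mono ?_)
        intro h hh
        refine ⟨hh, fun hB => hy ?_⟩
        rw [← hGinv h] at hB
        exact (smul_mem_smul_set_iff).1 hB
    rw [heq]
    refine IsGδ.iInter fun i => IsOpen.isGδ ?_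
    obtain ⟨n, σ, g, hg, d, rfl⟩ := i
    have hVg := hVV ⟨g, hg⟩ d
    simp only at hVg
    simp only [hVg]
    exact W_open A hbasis x α (β n) (Order.lt_add_one_iff.1 (hβα n)) _ (hfβ n) ⟨g, hg⟩ d
  exact isGδ_iff_eq_iInter_nat.1 hG
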